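/- For every (ξ, x) ∈ [0,1)², S(B(ξ, x)) = 2^{1/2} S(ξ, x) + 2π (−sin(2π B₂(ξ, x)), cos(2π B₂(ξ, x))). Equivalently, G(ξ, x, S(ξ, x)) = (B(ξ, x), S(B(ξ, x))), i.e. the graph of S is invariant under the Anosov skew product G. -/

import Mathlib

open Real MeasureTheory Set Filter

noncomputable section

/-- The Euclidean plane. -/
abbrev E2 : Type := EuclideanSpace ℝ (Fin 2)

/-- The unit vector `(cos t, sin t)` in the Euclidean plane. -/
def cs (t : ℝ) : E2 := (WithLp.equiv 2 (Fin 2 → ℝ)).symm ![Real.cos t, Real.sin t]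

/-- The vector `(-sin t, cos t)` in the Euclidean plane. -/
def cs' (t : ℝ) : E2 := (WithLp.equiv 2 (Fin 2 → ℝ)).symm ![-Real.sin t, Real.cos t]

/-- The two-dimensional Weierstrass function
`W(x) = ∑_{n≥0} 2^{-n/2} (cos (2π 2^n x), sin (2π 2^n x))`. -/
def Wfn (x : ℝ) : E2 := ∑' n : ℕ, (2 : ℝ) ^ (-(n : ℝ) / 2) • cs (2 * π * 2 ^ n * x)

/-- `dig j ξ` is the `j`-th binary digit of `ξ`: `⌊2^j ξ⌋ mod 2` (as a real number). -/
def dig (j : ℕ) (ξ : ℝ) : ℝ := ((⌊(2 : ℝ) ^ j * ξ⌋ % 2 : ℤ) : ℝ)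

/-- `rho n ξ = ∑_{i=1}^n d_{n+1-i}(ξ) 2^{-i}`. -/
def rho (n : ℕ) (ξ : ℝ) : ℝ := ∑ i ∈ Finset.Icc 1 n, dig (n + 1 - i) ξ / 2 ^ i

/-- `x` is a dyadic rational. -/
def dyadic (x : ℝ) : Prop := ∃ (k : ℕ) (m : ℤ), x = (m : ℝ) / 2 ^ k

/-- The stable-direction function
`S(ξ,x) = -2π ∑_{n≥1} 2^{-n/2} (-sin (2π(ρ_n(ξ)+x/2^n)), cos (2π(ρ_n(ξ)+x/2^n)))`. -/
def Sfn (ξ x : ℝ) : E2 :=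
  (-(2 * π)) • ∑' n : ℕ,
    (2 : ℝ) ^ (-((n : ℝ) + 1) / 2) • cs' (2 * π * (rho (n + 1) ξ + x / 2 ^ (n + 1)))

/-- The function `H` given by the doubly infinite series
`H(ξ,x) = ∑_{n≥0} 2^{-n/2} ((cos,sin)(2π 2^n x) - (1,0))
        + ∑_{k≥1} 2^{k/2} ((cos,sin)(2π(ρ_k(ξ)+x/2^k)) - (cos,sin)(2π ρ_k(ξ)))`. -/
def Hfn (ξ x : ℝ) : E2 :=
  (∑' n : ℕ, (2 : ℝ) ^ (-(n : ℝ) / 2) •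
      (cs (2 * π * 2 ^ n * x) - (WithLp.equiv 2 (Fin 2 → ℝ)).symm ![1, 0]))
  + ∑' k : ℕ, (2 : ℝ) ^ (((k : ℝ) + 1) / 2) •
      (cs (2 * π * (rho (k + 1) ξ + x / 2 ^ (k + 1))) - cs (2 * π * rho (k + 1) ξ))

/-- The baker transformation `B(ξ,x) = (2ξ mod 1, (⌊2ξ⌋ + x)/2)`. -/
def baker (p : ℝ × ℝ) : ℝ × ℝ :=
  (Int.fract (2 * p.1), ((⌊2 * p.1⌋ : ℝ) + p.2) / 2)

/-- The unit square `[0,1)²`. -/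
def usq : Set (ℝ × ℝ) := Ico (0:ℝ) 1 ×ˢ Ico (0:ℝ) 1

/-- The explicit formula for the `N`-th backward iterate of the baker transformation:
`B^{-N}(ξ,x) = (ξ/2^N + ∑_{j=1}^N d_j(x) 2^{-(N+1-j)}, 2^N x mod 1)`. -/
def bakerInvN (N : ℕ) (p : ℝ × ℝ) : ℝ × ℝ :=
  (p.1 / 2 ^ N + ∑ j ∈ Finset.Icc 1 N, dig j p.2 / 2 ^ (N + 1 - j),
    Int.fract ((2 : ℝ) ^ N * p.2))

/-- The Anosov skew product
`G(ξ,x,v) = (B(ξ,x), 2^{1/2} v + 2π(-sin, cos)(2π B₂(ξ,x)))`. -/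
def Gfn (q : (ℝ × ℝ) × E2) : (ℝ × ℝ) × E2 :=
  (baker q.1, (2 : ℝ) ^ ((1:ℝ)/2) • q.2 + (2 * π) • cs' (2 * π * (baker q.1).2))

lemma norm_cs' (t : ℝ) : ‖cs' t‖ = 1 := by
  simp [cs', EuclideanSpace.norm_eq]

lemma two_rpow_neg_half (n : ℕ) :
    (2 : ℝ) ^ (-((n : ℝ) + 1) / 2) = (2 : ℝ) ^ (-(1 : ℝ) / 2) * ((2 : ℝ) ^ (-(1 : ℝ) / 2)) ^ n := by
  rw [← Real.rpow_natCast, ← Real.rpow_mul (by norm_num), ← Real.rpow_add (by norm_num)]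
  congr 1
  ring

lemma summable_two_rpow_smul_cs' (θ : ℕ → ℝ) :
    Summable fun n : ℕ => (2 : ℝ) ^ (-((n : ℝ) + 1) / 2) • cs' (θ n) := by
  apply Summable.of_norm
  have hs : Summable fun n : ℕ =>
      (2 : ℝ) ^ (-(1 : ℝ) / 2) * ((2 : ℝ) ^ (-(1 : ℝ) / 2)) ^ n :=
    (summable_geometric_of_lt_one (by positivity)
      (Real.rpow_lt_one_of_one_lt_of_neg (by norm_num) (by norm_num))).mul_left _
  refine hs.congr fun n => ?_
  rw [norm_smul, norm_cs', mul_one, Real.norm_of_nonneg (by positivity), two_rpow_neg_half]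

/-- Doubling modulo one shifts the binary digits. -/
lemma dig_fract_two_mul {j : ℕ} (hj : 1 ≤ j) (ξ : ℝ) :
    dig j (Int.fract (2 * ξ)) = dig (j + 1) ξ := by
  obtain ⟨k, rfl⟩ := Nat.exists_eq_add_of_le' hj
  have h : (2 : ℝ) ^ (k + 1) * Int.fract (2 * ξ)
      = 2 ^ (k + 1 + 1) * ξ - ((2 * (2 ^ k * ⌊2 * ξ⌋) : ℤ) : ℝ) := by
    rw [Int.fract]
    push_cast
    ring
  unfold dig
  rw [h, Int.floor_sub_intCast, Int.sub_mul_emod_self_left]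

lemma dig_one {ξ : ℝ} (hξ : ξ ∈ Ico (0 : ℝ) 1) : dig 1 ξ = ⌊2 * ξ⌋ := by
  have h0 : 0 ≤ ⌊2 * ξ⌋ := Int.floor_nonneg.mpr (by linarith [hξ.1])
  have h1 : ⌊2 * ξ⌋ < 2 := Int.floor_lt.mpr (by push_cast; linarith [hξ.2])
  rw [dig, pow_one, Int.emod_eq_of_lt h0 h1]

/-- The angles in the series for `S` are shifted by the baker transformation. -/
lemma rho_baker {ξ : ℝ} (hξ : ξ ∈ Ico (0 : ℝ) 1) (x : ℝ) (n : ℕ) :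
    rho n (baker (ξ, x)).1 + (baker (ξ, x)).2 / 2 ^ n = rho (n + 1) ξ + x / 2 ^ (n + 1) := by
  have h : rho (n + 1) ξ = rho n (Int.fract (2 * ξ)) + ⌊2 * ξ⌋ / 2 ^ (n + 1) := by
    unfold rho
    rw [Finset.sum_Icc_succ_top (by omega), Nat.add_sub_cancel_left, dig_one hξ]
    congr 1
    refine Finset.sum_congr rfl fun i hi => ?_
    have hi := Finset.mem_Icc.mp hi
    rw [dig_fract_two_mul (by omega), show n + 1 + 1 - i = n + 1 - i + 1 by omega]
  rw [h]
  simp only [baker]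
  field_simp
  ring

lemma Sfn_baker {ξ : ℝ} (hξ : ξ ∈ Ico (0 : ℝ) 1) (x : ℝ) :
    Sfn (baker (ξ, x)).1 (baker (ξ, x)).2
      = (2 : ℝ) ^ ((1:ℝ)/2) • Sfn ξ x + (2 * π) • cs' (2 * π * (baker (ξ, x)).2) := by
  have h0 : rho (0 + 1) ξ + x / 2 ^ (0 + 1) = (baker (ξ, x)).2 := by
    simpa [rho] using (rho_baker hξ x 0).symm
  have hpow (n : ℕ) : (2 : ℝ) ^ ((1 : ℝ) / 2) * (2 : ℝ) ^ (-(((n + 1 : ℕ) : ℝ) + 1) / 2)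
      = (2 : ℝ) ^ (-((n : ℝ) + 1) / 2) := by
    rw [← Real.rpow_add (by norm_num)]
    congr 1
    push_cast
    ring
  have hpow0 : (2 : ℝ) ^ ((1 : ℝ) / 2) * (2 : ℝ) ^ (-(((0 : ℕ) : ℝ) + 1) / 2) = 1 := by
    rw [← Real.rpow_add (by norm_num)]
    norm_num
  have hs := summable_two_rpow_smul_cs' fun n => 2 * π * (rho (n + 1) ξ + x / 2 ^ (n + 1))
  have key : (2 : ℝ) ^ ((1 : ℝ) / 2) • ∑' n : ℕ, (2 : ℝ) ^ (-((n : ℝ) + 1) / 2) •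
        cs' (2 * π * (rho (n + 1) ξ + x / 2 ^ (n + 1)))
      = cs' (2 * π * (baker (ξ, x)).2) + ∑' n : ℕ, (2 : ℝ) ^ (-((n : ℝ) + 1) / 2) •
        cs' (2 * π * (rho (n + 1) (baker (ξ, x)).1 + (baker (ξ, x)).2 / 2 ^ (n + 1))) := by
    rw [← hs.tsum_const_smul, (hs.const_smul _).tsum_eq_zero_add, smul_smul, hpow0, one_smul, h0]
    congr 1
    refine tsum_congr fun n => ?_
    rw [smul_smul, hpow, rho_baker hξ]
  unfold Sfn
  rw [smul_comm, key, smul_add, neg_smul, neg_smul]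
  abel

/-- `S(B(ξ,x)) = 2^{1/2} S(ξ,x) + 2π(-sin, cos)(2π B₂(ξ,x))`; equivalently the graph of `S`
is invariant under the Anosov skew product `G`: `G(ξ,x,S(ξ,x)) = (B(ξ,x), S(B(ξ,x)))`. -/
theorem S_graph_invariant :
    ∀ ξ x : ℝ, ξ ∈ Ico (0:ℝ) 1 → x ∈ Ico (0:ℝ) 1 →
      Sfn (baker (ξ, x)).1 (baker (ξ, x)).2
          = (2 : ℝ) ^ ((1:ℝ)/2) • Sfn ξ x + (2 * π) • cs' (2 * π * (baker (ξ, x)).2) ∧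
        Gfn ((ξ, x), Sfn ξ x) = (baker (ξ, x), Sfn (baker (ξ, x)).1 (baker (ξ, x)).2) := by
  intro ξ x hξ _
  exact ⟨Sfn_baker hξ x, Prod.ext rfl (Sfn_baker hξ x).symm⟩

end
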